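/- arXiv:2006.11192 — 3 statements merged into one kernel-verified Lean document; each statement's English description precedes it below -/
import Mathlib

section
/- Let A be an n×n real matrix, B_u an n×m real matrix, Q a symmetric positive semidefinite n×n real matrix, R a symmetric positive semidefinite m×m real matrix, and K an m×n real matrix such that A + B_u·K is Hurwitz. Then there exist a symmetric positive definite n×n real matrix Y and the matrix W = K·Y such that the symmetric matrix A·Y + Y·Aᵀ + B_u·W + Wᵀ·B_uᵀ + Y·Q·Y + Wᵀ·R·W is negative definite. -/
open Matrix
open scoped Matrix

/-- A symmetric real matrix is negative definite if `xᵀ M x < 0` for all nonzero `x`. -/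
def Matrix.NegDef {m : Type*} [Fintype m] (M : Matrix m m ℝ) : Prop :=
  M.IsSymm ∧ ∀ x : m → ℝ, x ≠ 0 → x ⬝ᵥ (M *ᵥ x) < 0

/-- A real square matrix is Hurwitz if every eigenvalue of it, viewed as a complex
matrix, has strictly negative real part. -/
def IsHurwitz {n : ℕ} (A : Matrix (Fin n) (Fin n) ℝ) : Prop :=
  ∀ μ ∈ spectrum ℂ (A.map (Complex.ofReal : ℝ → ℂ)), μ.re < 0

open scoped Topology
open Filter

/-- Powers of an element of spectral radius less than one tend to zero. -/
theorem tendsto_pow_zero_of_spectralRadius_lt_one {𝔸 : Type*} [NormedRing 𝔸] [NormedAlgebra ℂ 𝔸]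
    [CompleteSpace 𝔸] {a : 𝔸} (ha : spectralRadius ℂ a < 1) :
    Tendsto (fun k : ℕ => a ^ k) atTop (𝓝 0) := by
  obtain ⟨r, har, hr⟩ := ENNReal.lt_iff_exists_nnreal_btwn.mp ha
  have hr : (r : ℝ) < 1 := by exact_mod_cast hr
  refine squeeze_zero_norm' ?_ (tendsto_pow_atTop_nhds_zero_of_lt_one r.2 hr)
  filter_upwards [(spectrum.pow_nnnorm_pow_one_div_tendsto_nhds_spectralRadius a).eventually_lt_const
    har, eventually_gt_atTop 0] with k hk hk0
  have hk0' : (0 : ℝ) < k := by exact_mod_cast hk0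
  rw [one_div, ENNReal.rpow_inv_lt_iff hk0', ENNReal.rpow_natCast] at hk
  exact_mod_cast hk.le

section L2Operator

open scoped Matrix.Norms.L2Operator

variable {n : Type*} [Fintype n] [DecidableEq n]

/-- If every point of the spectrum of a complex matrix lies in the open left half-plane, then a
sufficiently small forward Euler step has spectral radius less than one. -/
theorem Matrix.exists_spectralRadius_one_add_smul_lt_one {A : Matrix n n ℂ}
    (hA : ∀ μ ∈ spectrum ℂ A, μ.re < 0) :
    ∃ h : ℝ, 0 < h ∧ spectralRadius ℂ (1 + (h : ℂ) • A) < 1 := by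
  have step : ∀ μ ∈ spectrum ℂ A, ∀ᶠ h : ℝ in 𝓝[>] 0, ‖1 + (h : ℂ) * μ‖ < 1 := by
    intro μ hμ
    have hlim : Tendsto (fun h : ℝ => 2 * μ.re + h * Complex.normSq μ) (𝓝[>] 0)
        (𝓝 (2 * μ.re + 0 * Complex.normSq μ)) :=
      (Continuous.tendsto (by fun_prop) 0).mono_left nhdsWithin_le_nhds
    filter_upwards [hlim.eventually_lt_const (u := 0) (by linarith [hA μ hμ]),
      self_mem_nhdsWithin] with h hneg hpos
    rw [← sq_lt_one_iff₀ (norm_nonneg _), ← Complex.normSq_eq_norm_sq, Complex.normSq_apply]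
    rw [Complex.normSq_apply] at hneg
    simp only [Complex.add_re, Complex.one_re, Complex.re_ofReal_mul, Complex.add_im,
      Complex.one_im, Complex.im_ofReal_mul]
    nlinarith [mul_neg_of_pos_of_neg hpos hneg]
  obtain ⟨h, hh, hpos⟩ := (((Matrix.finite_spectrum A).eventually_all.mpr step).and
    self_mem_nhdsWithin).exists
  refine ⟨h, hpos, ?_⟩
  rcases (spectrum ℂ (1 + (h : ℂ) • A)).eq_empty_or_nonempty with he | hne
  · simp only [spectralRadius, he]
    simp
  refine spectrum.spectralRadius_lt_of_forall_lt_of_nonempty hne (r := 1) fun z hz => ?_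
  have hh0 : (h : ℂ) ≠ 0 := by exact_mod_cast (ne_of_gt hpos)
  rw [← map_one (algebraMap ℂ (Matrix n n ℂ)), ← spectrum.singleton_add_eq,
    ← Units.smul_mk0 hh0, spectrum.unit_smul_eq_smul] at hz
  obtain ⟨_, rfl, _, ⟨μ, hμ, rfl⟩, rfl⟩ := hz
  exact_mod_cast hh μ hμ

/-- The quadratic form of a real matrix is bounded by its operator norm. -/
theorem Matrix.dotProduct_mulVec_le_norm (M : Matrix n n ℝ) (x : n → ℝ) :
    x ⬝ᵥ (M *ᵥ x) ≤ ‖M‖ * (x ⬝ᵥ x) := by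
  have hM := Matrix.l2_opNorm_mulVec M (WithLp.toLp 2 x)
  have hx : x ⬝ᵥ x = ‖WithLp.toLp 2 x‖ ^ 2 := by
    rw [EuclideanSpace.real_norm_sq_eq]
    simp [dotProduct, sq]
  have hin : x ⬝ᵥ (M *ᵥ x) = inner ℝ (WithLp.toLp 2 (M *ᵥ x)) (WithLp.toLp 2 x) := by
    simp [EuclideanSpace.inner_eq_star_dotProduct]
  rw [hin, hx]
  calc _ ≤ ‖WithLp.toLp 2 (M *ᵥ x)‖ * ‖WithLp.toLp 2 x‖ := real_inner_le_norm _ _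
    _ ≤ (‖M‖ * ‖WithLp.toLp 2 x‖) * ‖WithLp.toLp 2 x‖ := by gcongr; exact hM
    _ = _ := by ring

/-- The truncated Gramian of `C` solves a discrete Lyapunov (Stein) equation up to the remainder
`C ^ N * (C ^ N)ᵀ`. -/
theorem Matrix.sum_pow_mul_transpose_stein (C : Matrix n n ℝ) (N : ℕ) :
    C * (∑ k ∈ Finset.range N, C ^ k * (C ^ k)ᵀ) * Cᵀ + 1 =
      (∑ k ∈ Finset.range N, C ^ k * (C ^ k)ᵀ) + C ^ N * (C ^ N)ᵀ := by
  rw [← Finset.sum_range_succ (fun k => C ^ k * (C ^ k)ᵀ), Finset.sum_range_succ']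
  simp [Finset.mul_sum, Finset.sum_mul, pow_succ', Matrix.mul_assoc]

/-- A Hurwitz matrix admits a Lyapunov certificate with a uniform decay constant. -/
theorem IsHurwitz.exists_lyapunov {n : ℕ} {A : Matrix (Fin n) (Fin n) ℝ} (hA : IsHurwitz A) :
    ∃ P : Matrix (Fin n) (Fin n) ℝ, P.PosDef ∧ ∃ c : ℝ, 0 < c ∧
      ∀ x : Fin n → ℝ, x ⬝ᵥ ((A * P + P * Aᵀ) *ᵥ x) ≤ -c * (x ⬝ᵥ x) := by
  obtain ⟨h, hpos, hρ⟩ := Matrix.exists_spectralRadius_one_add_smul_lt_one hA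
  set C : Matrix (Fin n) (Fin n) ℝ := 1 + h • A with hC
  have hmap : ∀ k : ℕ, C ^ k =
      ((1 + (h : ℂ) • A.map (Complex.ofReal : ℝ → ℂ)) ^ k).map Complex.re := by
    intro k
    have h1 : 1 + (h : ℂ) • A.map (Complex.ofReal : ℝ → ℂ) = Complex.ofRealHom.mapMatrix C := by
      rw [hC, map_add, map_one]
      ext i j
      simp
    rw [h1, ← map_pow]
    ext i j
    simp
  have hpow : Tendsto (fun k : ℕ => C ^ k) atTop (𝓝 0) := by
    have hre : Continuous fun M : Matrix (Fin n) (Fin n) ℂ => M.map Complex.re :=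
      continuous_id.matrix_map Complex.continuous_re
    have := (hre.tendsto 0).comp (tendsto_pow_zero_of_spectralRadius_lt_one hρ)
    simpa only [Function.comp_def, ← hmap, Matrix.map_zero _ Complex.zero_re] using this
  have hsq : Tendsto (fun k : ℕ => ‖C ^ k * (C ^ k)ᵀ‖) atTop (𝓝 0) := by
    have hcont : Continuous fun M : Matrix (Fin n) (Fin n) ℝ => ‖M * Mᵀ‖ :=
      (continuous_id.matrix_mul continuous_id.matrix_transpose).norm
    simpa [Function.comp_def] using (hcont.tendsto 0).comp hpow
  obtain ⟨N, hN, hN0⟩ :=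
    ((hsq.eventually_lt_const one_pos).and (eventually_gt_atTop 0)).exists
  set P := ∑ k ∈ Finset.range N, C ^ k * (C ^ k)ᵀ with hPdef
  have hterm : ∀ k : ℕ, (C ^ k * (C ^ k)ᵀ).PosSemidef := fun k => by
    simpa using Matrix.posSemidef_self_mul_conjTranspose (C ^ k)
  have hP : P.PosDef := by
    obtain ⟨N, rfl⟩ := Nat.exists_eq_succ_of_ne_zero hN0.ne'
    rw [hPdef, Finset.sum_range_succ']
    refine Matrix.PosDef.posSemidef_add (Matrix.posSemidef_sum _ fun k _ => hterm (k + 1)) ?_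
    simpa using Matrix.PosDef.one
  refine ⟨P, hP, (1 - ‖C ^ N * (C ^ N)ᵀ‖) / h, div_pos (by linarith) hpos, fun x => ?_⟩
  have hstein : h • (A * P + P * Aᵀ) =
      C ^ N * (C ^ N)ᵀ - 1 - (h * h) • (A * P * Aᵀ) := by
    have hS := Matrix.sum_pow_mul_transpose_stein C N
    rw [← hPdef] at hS
    have hexp : C * P * Cᵀ = P + h • (A * P + P * Aᵀ) + (h * h) • (A * P * Aᵀ) := by
      rw [hC]
      simp only [Matrix.transpose_add, Matrix.transpose_one, Matrix.transpose_smul,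
        Matrix.add_mul, Matrix.mul_add, Matrix.one_mul, Matrix.mul_one, Matrix.smul_mul,
        Matrix.mul_smul, smul_add, smul_smul]
      abel
    rw [hexp] at hS
    rw [eq_sub_iff_add_eq, eq_sub_iff_add_eq]
    apply add_left_cancel (a := P)
    rw [← hS]
    abel
  have hquad := congrArg (fun M : Matrix (Fin n) (Fin n) ℝ => x ⬝ᵥ (M *ᵥ x)) hstein
  simp only [Matrix.sub_mulVec, Matrix.smul_mulVec, Matrix.one_mulVec, dotProduct_sub,
    dotProduct_smul, smul_eq_mul] at hquad
  have hAPA : 0 ≤ x ⬝ᵥ ((A * P * Aᵀ) *ᵥ x) := by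
    simpa using (hP.posSemidef.mul_mul_conjTranspose_same A).dotProduct_mulVec_nonneg x
  have hle := Matrix.dotProduct_mulVec_le_norm (C ^ N * (C ^ N)ᵀ) x
  rw [← mul_le_mul_iff_right₀ hpos, hquad]
  have : h * (-((1 - ‖C ^ N * (C ^ N)ᵀ‖) / h) * (x ⬝ᵥ x)) =
      (‖C ^ N * (C ^ N)ᵀ‖ - 1) * (x ⬝ᵥ x) := by
    field_simp
    ring
  rw [this]
  nlinarith [mul_nonneg (mul_self_nonneg h) hAPA]

end L2Operator

open scoped Matrix.Norms.L2Operator in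
/-- A stabilizing gain `K` yields a feasible point of the LQR LMI with `W = K Y`. -/
theorem hurwitz_implies_lqr_lmi {n m : ℕ}
    (A : Matrix (Fin n) (Fin n) ℝ) (Bu : Matrix (Fin n) (Fin m) ℝ)
    (Q : Matrix (Fin n) (Fin n) ℝ) (R : Matrix (Fin m) (Fin m) ℝ)
    (K : Matrix (Fin m) (Fin n) ℝ)
    (hQ : Q.PosSemidef) (hR : R.PosSemidef)
    (hK : IsHurwitz (A + Bu * K)) :
    ∃ (Y : Matrix (Fin n) (Fin n) ℝ) (W : Matrix (Fin m) (Fin n) ℝ),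
      Y.PosDef ∧ W = K * Y ∧
      (A * Y + Y * Aᵀ + Bu * W + Wᵀ * Buᵀ + Y * Q * Y + Wᵀ * R * W).NegDef := by
  obtain ⟨P, hP, c, hc, hdecay⟩ := hK.exists_lyapunov
  have hPt : Pᵀ = P := by simpa using hP.isHermitian.eq
  have hQt : Qᵀ = Q := by simpa using hQ.isHermitian.eq
  have hRt : Rᵀ = R := by simpa using hR.isHermitian.eq
  set S := P * Q * P + (K * P)ᵀ * R * (K * P) with hS
  set ε : ℝ := c / (‖S‖ + 1) with hε
  have hS1 : 0 < ‖S‖ + 1 := by positivity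
  have hεpos : 0 < ε := div_pos hc hS1
  have hεS : ε * ‖S‖ < c := by
    have : ε * (‖S‖ + 1) = c := div_mul_cancel₀ c hS1.ne'
    linarith
  refine ⟨ε • P, K * (ε • P), hP.smul hεpos, rfl, ?_, fun x hx => ?_⟩
  · simp only [Matrix.IsSymm, Matrix.transpose_add, Matrix.transpose_mul, Matrix.transpose_smul,
      Matrix.transpose_transpose, hPt, hQt, hRt, Matrix.mul_assoc]
    abel
  have hfactor : A * (ε • P) + (ε • P) * Aᵀ + Bu * (K * (ε • P)) + (K * (ε • P))ᵀ * Buᵀ +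
      (ε • P) * Q * (ε • P) + (K * (ε • P))ᵀ * R * (K * (ε • P)) =
      ε • ((A + Bu * K) * P + P * (A + Bu * K)ᵀ + ε • S) := by
    simp only [hS, Matrix.transpose_add, Matrix.transpose_mul, Matrix.transpose_smul, hPt,
      Matrix.add_mul, Matrix.mul_add, Matrix.smul_mul, Matrix.mul_smul, smul_add,
      Matrix.mul_assoc]
    abel
  have hxx : 0 < x ⬝ᵥ x := by simpa using Matrix.dotProduct_star_self_pos_iff.mpr hx
  rw [hfactor, Matrix.smul_mulVec, dotProduct_smul, Matrix.add_mulVec, dotProduct_add,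
    Matrix.smul_mulVec, dotProduct_smul, smul_eq_mul, smul_eq_mul]
  refine mul_neg_of_pos_of_neg hεpos ?_
  have hSx := mul_le_mul_of_nonneg_left (Matrix.dotProduct_mulVec_le_norm S x) hεpos.le
  nlinarith [hdecay x, mul_lt_mul_of_pos_right hεS hxx]
end

section
/- Let A be an n×n real matrix, B_u an n×m real matrix, B_w an n×q real matrix, C_z a p×n real matrix, D_u a p×m real matrix, and γ > 0. Suppose there exist a symmetric positive definite n×n real matrix X, an m×n real matrix W, and a symmetric p×p real matrix Z such that: (i) A·X + B_u·W + (A·X + B_u·W)ᵀ + B_w·B_wᵀ is negative definite; (ii) the block matrix [[−Z, C_z·X + D_u·W],[(C_z·X + D_u·W)ᵀ, −X]] is negative definite; and (iii) trace(Z) < γ². Then, with K = W·X⁻¹, the closed-loop matrix A + B_u·K is Hurwitz, and the unique solution P of the Lyapunov equation (A + B_u·K)·P + P·(A + B_u·K)ᵀ + B_w·B_wᵀ = 0 satisfies trace( (C_z + D_u·K)·P·(C_z + D_u·K)ᵀ ) < γ². -/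
open Matrix
open scoped Matrix

namespace Matrix

variable {ι : Type*} [Fintype ι]

/-- The quadratic form of `F Y + Y Fᵀ` for symmetric `Y`. -/
lemma dotProduct_lyapunov_mulVec (F : Matrix ι ι ℝ) {Y : Matrix ι ι ℝ} (hY : Y.IsSymm)
    (x : ι → ℝ) :
    x ⬝ᵥ ((F * Y + Y * Fᵀ) *ᵥ x) = 2 * ((Fᵀ *ᵥ x) ⬝ᵥ (Y *ᵥ x)) := by
  have h : x ⬝ᵥ (Y *ᵥ (Fᵀ *ᵥ x)) = (Fᵀ *ᵥ x) ⬝ᵥ (Y *ᵥ x) := by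
    rw [dotProduct_mulVec, ← mulVec_transpose, hY.eq, dotProduct_comm]
  rw [add_mulVec, dotProduct_add, ← mulVec_mulVec, ← mulVec_mulVec, h, dotProduct_mulVec,
    ← mulVec_transpose, two_mul]

/-- A generalized Rayleigh quotient attains its minimum. -/
lemma PosDef.exists_dotProduct_mulVec_min [Nonempty ι] {X : Matrix ι ι ℝ} (hX : X.PosDef)
    (Y : Matrix ι ι ℝ) :
    ∃ (c : ℝ) (v : ι → ℝ), v ≠ 0 ∧ v ⬝ᵥ (Y *ᵥ v) = c * (v ⬝ᵥ (X *ᵥ v)) ∧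
      ∀ x : ι → ℝ, c * (x ⬝ᵥ (X *ᵥ x)) ≤ x ⬝ᵥ (Y *ᵥ x) := by
  have pos : ∀ x : ι → ℝ, x ≠ 0 → 0 < x ⬝ᵥ (X *ᵥ x) := fun x hx => by
    simpa using hX.dotProduct_mulVec_pos hx
  have ne : ∀ x ∈ Metric.sphere (0 : ι → ℝ) 1, x ≠ 0 := fun x hx =>
    ne_zero_of_mem_unit_sphere ⟨x, hx⟩
  obtain ⟨v, hv, hmin⟩ := (isCompact_sphere (0 : ι → ℝ) 1).exists_isMinOn
    (NormedSpace.sphere_nonempty.mpr zero_le_one)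
    (f := fun x => (x ⬝ᵥ (Y *ᵥ x)) / (x ⬝ᵥ (X *ᵥ x)))
    (ContinuousOn.div (by fun_prop) (by fun_prop) fun x hx => (pos x (ne x hx)).ne')
  refine ⟨(v ⬝ᵥ (Y *ᵥ v)) / (v ⬝ᵥ (X *ᵥ v)), v, ne v hv,
    (div_mul_cancel₀ _ (pos v (ne v hv)).ne').symm, fun x => ?_⟩
  rcases eq_or_ne x 0 with rfl | hx
  · simp
  have hn : ‖x‖⁻¹ ≠ 0 := inv_ne_zero (norm_ne_zero_iff.mpr hx)
  have hs : ‖x‖⁻¹ • x ∈ Metric.sphere (0 : ι → ℝ) 1 := by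
    simp [norm_smul, norm_ne_zero_iff.mpr hx]
  have h := isMinOn_iff.mp hmin _ hs
  simp only [mulVec_smul, smul_dotProduct, dotProduct_smul, smul_eq_mul] at h
  rw [mul_div_mul_left _ _ hn, mul_div_mul_left _ _ hn] at h
  exact (le_div_iff₀ (pos x hx)).mp h

/-- If `X` is a positive definite strict Lyapunov certificate for `F`, then symmetric
solutions of the Lyapunov inequality `F Y + Y Fᵀ ≤ 0` are positive semidefinite. -/
lemma posSemidef_of_lyapunov {F X Y : Matrix ι ι ℝ} (hX : X.PosDef)
    (hFX : ∀ x : ι → ℝ, x ≠ 0 → x ⬝ᵥ ((F * X + X * Fᵀ) *ᵥ x) < 0) (hY : Y.IsSymm)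
    (hFY : ∀ x : ι → ℝ, x ⬝ᵥ ((F * Y + Y * Fᵀ) *ᵥ x) ≤ 0) : Y.PosSemidef := by
  have hXs : X.IsSymm := hX.isHermitian
  cases isEmpty_or_nonempty ι
  · rw [Subsingleton.elim Y 0]
    exact PosSemidef.zero
  obtain ⟨c, v, hv, hveq, hle⟩ := hX.exists_dotProduct_mulVec_min Y
  have hS : (Y - c • X).PosSemidef := by
    refine .of_dotProduct_mulVec_nonneg (hY.sub (hXs.smul c)) fun x => ?_
    simpa [sub_mulVec, smul_mulVec, dotProduct_sub] using hle x
  have hker : (Y - c • X) *ᵥ v = 0 := by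
    rw [← hS.dotProduct_mulVec_zero_iff]
    simp [sub_mulVec, smul_mulVec, dotProduct_sub, hveq]
  have hYv : Y *ᵥ v = c • (X *ᵥ v) := by
    rwa [sub_mulVec, smul_mulVec, sub_eq_zero] at hker
  have h1 := hFX v hv
  have h2 := hFY v
  rw [dotProduct_lyapunov_mulVec F hXs] at h1
  rw [dotProduct_lyapunov_mulVec F hY, hYv, dotProduct_smul, smul_eq_mul] at h2
  have hc : 0 ≤ c := by
    by_contra! hc
    nlinarith [mul_pos_of_neg_of_neg hc h1]
  refine .of_dotProduct_mulVec_nonneg hY fun x => ?_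
  have hx := hX.posSemidef.dotProduct_mulVec_nonneg x
  rw [star_trivial] at hx ⊢
  exact (mul_nonneg hc hx).trans (hle x)

/-- A strict Lyapunov certificate makes the homogeneous Lyapunov equation uniquely solvable. -/
lemma eq_zero_of_lyapunov_eq_zero {F X Y : Matrix ι ι ℝ} (hX : X.PosDef)
    (hFX : ∀ x : ι → ℝ, x ≠ 0 → x ⬝ᵥ ((F * X + X * Fᵀ) *ᵥ x) < 0)
    (hFY : F * Y + Y * Fᵀ = 0) : Y = 0 := by
  -- `Y` need not be symmetric, so pass to the symmetric dilation `[[0, Y], [Yᵀ, 0]]`.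
  have hXs : X.IsSymm := hX.isHermitian
  let F' := fromBlocks F 0 0 F
  let X' := fromBlocks X 0 0 X
  let Y' := fromBlocks 0 Y Yᵀ 0
  have quad : ∀ (M : Matrix ι ι ℝ) (x : ι ⊕ ι → ℝ), x ⬝ᵥ (fromBlocks M 0 0 M *ᵥ x) =
      (x ∘ Sum.inl) ⬝ᵥ (M *ᵥ (x ∘ Sum.inl)) + (x ∘ Sum.inr) ⬝ᵥ (M *ᵥ (x ∘ Sum.inr)) := by
    intro M x
    simp [fromBlocks_mulVec, dotProduct]
  have split : ∀ x : ι ⊕ ι → ℝ, x ≠ 0 → x ∘ Sum.inl ≠ 0 ∨ x ∘ Sum.inr ≠ 0 := by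
    intro x hx
    by_contra! h
    exact hx (funext (Sum.rec (congrFun h.1) (congrFun h.2)))
  have posX : ∀ x : ι → ℝ, x ≠ 0 → 0 < x ⬝ᵥ (X *ᵥ x) := fun x hx => by
    simpa using hX.dotProduct_mulVec_pos hx
  have nonnegX : ∀ x : ι → ℝ, 0 ≤ x ⬝ᵥ (X *ᵥ x) := fun x => by
    simpa using hX.posSemidef.dotProduct_mulVec_nonneg x
  have nonpos : ∀ x : ι → ℝ, x ⬝ᵥ ((F * X + X * Fᵀ) *ᵥ x) ≤ 0 := fun x => by
    rcases eq_or_ne x 0 with rfl | hx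
    · simp
    · exact (hFX x hx).le
  have hX' : X'.PosDef := by
    refine .of_dotProduct_mulVec_pos (hXs.fromBlocks (by simp) hXs) fun x hx => ?_
    rw [star_trivial, quad]
    rcases split x hx with h | h
    · exact add_pos_of_pos_of_nonneg (posX _ h) (nonnegX _)
    · exact add_pos_of_nonneg_of_pos (nonnegX _) (posX _ h)
  have hFX' : ∀ x : ι ⊕ ι → ℝ, x ≠ 0 → x ⬝ᵥ ((F' * X' + X' * F'ᵀ) *ᵥ x) < 0 := by
    intro x hx
    have : F' * X' + X' * F'ᵀ = fromBlocks (F * X + X * Fᵀ) 0 0 (F * X + X * Fᵀ) := by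
      simp [F', X', fromBlocks_transpose, fromBlocks_multiply, fromBlocks_add]
    rw [this, quad]
    rcases split x hx with h | h
    · exact add_neg_of_neg_of_nonpos (hFX _ h) (nonpos _)
    · exact add_neg_of_nonpos_of_neg (nonpos _) (hFX _ h)
  have hYs : Y'.IsSymm := IsSymm.fromBlocks (by simp) rfl (by simp)
  have hFYt : F * Yᵀ + Yᵀ * Fᵀ = 0 := by
    simpa [add_comm] using congrArg transpose hFY
  have hFY' : F' * Y' + Y' * F'ᵀ = 0 := by
    simp [F', Y', fromBlocks_transpose, fromBlocks_multiply, fromBlocks_add, hFY, hFYt]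
  have hpos : Y'.PosSemidef := posSemidef_of_lyapunov hX' hFX' hYs (by simp [hFY'])
  have hker : ∀ x : ι → ℝ, Y *ᵥ x = 0 := by
    intro x
    have h := (hpos.dotProduct_mulVec_zero_iff (Sum.elim 0 x)).mp
      (by simp [Y', fromBlocks_mulVec])
    simpa [Y', fromBlocks_mulVec] using congrArg (· ∘ Sum.inl) h
  classical
  exact ext_of_mulVec_single fun i => by rw [hker, zero_mulVec]

/-- A strict Lyapunov certificate makes every Lyapunov equation uniquely solvable. -/
lemma existsUnique_lyapunov {F X : Matrix ι ι ℝ} (hX : X.PosDef)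
    (hFX : ∀ x : ι → ℝ, x ≠ 0 → x ⬝ᵥ ((F * X + X * Fᵀ) *ᵥ x) < 0) (Q : Matrix ι ι ℝ) :
    ∃! P : Matrix ι ι ℝ, F * P + P * Fᵀ + Q = 0 := by
  let L : Matrix ι ι ℝ →ₗ[ℝ] Matrix ι ι ℝ :=
    LinearMap.mulLeft ℝ F + LinearMap.mulRight ℝ Fᵀ
  have hL : Function.Injective L := (injective_iff_map_eq_zero L).mpr fun Y hY =>
    eq_zero_of_lyapunov_eq_zero hX hFX hY
  obtain ⟨P, hP⟩ := LinearMap.injective_iff_surjective.mp hL (-Q)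
  exact ⟨P, eq_neg_iff_add_eq_zero.mp hP, fun P' hP' =>
    hL ((eq_neg_iff_add_eq_zero.mpr hP').trans hP.symm)⟩

/-- The Schur complement inequality `C X Cᵀ ≤ Z`, on traces. -/
lemma trace_le_of_fromBlocks_negDef {κ : Type*} [Fintype κ] {X : Matrix ι ι ℝ}
    {Z : Matrix κ κ ℝ} {C : Matrix κ ι ℝ} (hX : X.IsSymm)
    (h : (fromBlocks (-Z) (C * X) (C * X)ᵀ (-X)).NegDef) :
    (C * X * Cᵀ).trace ≤ Z.trace := by
  classical
  refine Finset.sum_le_sum fun i _ => ?_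
  have hx : Sum.elim (Pi.single i 1) (Cᵀ *ᵥ Pi.single i 1) ≠ (0 : κ ⊕ ι → ℝ) := fun h0 => by
    simpa using congrFun h0 (Sum.inl i)
  have hneg := h.2 _ hx
  have hcancel : (C * X)ᵀ *ᵥ Pi.single i 1 + (-X) *ᵥ (Cᵀ *ᵥ Pi.single i 1) = 0 := by
    rw [transpose_mul, hX.eq, neg_mulVec, mulVec_mulVec, add_neg_cancel]
  rw [fromBlocks_mulVec] at hneg
  rw [Sum.elim_comp_inl, Sum.elim_comp_inr, hcancel, sumElim_dotProduct_sumElim,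
    dotProduct_zero, add_zero, mulVec_mulVec, ← add_mulVec] at hneg
  simpa using hneg.le

end Matrix

/-- Lyapunov's stability criterion. -/
lemma isHurwitz_of_lyapunov {n : ℕ} {F X : Matrix (Fin n) (Fin n) ℝ} (hX : X.PosDef)
    (hFX : ∀ x : Fin n → ℝ, x ≠ 0 → x ⬝ᵥ ((F * X + X * Fᵀ) *ᵥ x) < 0) : IsHurwitz F := by
  intro μ hμ
  have hXs : X.IsSymm := hX.isHermitian
  obtain ⟨v, hv0, hv⟩ : ∃ v : Fin n → ℂ, v ≠ 0 ∧ (F.map Complex.ofReal)ᵀ *ᵥ v = μ • v := by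
    rw [spectrum.mem_iff, Matrix.isUnit_iff_isUnit_det, isUnit_iff_ne_zero, not_not,
      ← Matrix.det_transpose] at hμ
    obtain ⟨v, hv0, hv⟩ := Matrix.exists_mulVec_eq_zero_iff.mpr hμ
    refine ⟨v, hv0, ?_⟩
    rw [Algebra.algebraMap_eq_smul_one, transpose_sub, transpose_smul, transpose_one,
      sub_mulVec, smul_mulVec, one_mulVec, sub_eq_zero] at hv
    exact hv.symm
  let a : Fin n → ℝ := fun i => (v i).re
  let b : Fin n → ℝ := fun i => (v i).im
  have ha : Fᵀ *ᵥ a = μ.re • a - μ.im • b := by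
    ext i
    simpa [a, b, mulVec, dotProduct] using congrArg Complex.re (congrFun hv i)
  have hb : Fᵀ *ᵥ b = μ.re • b + μ.im • a := by
    ext i
    simpa [a, b, mulVec, dotProduct] using congrArg Complex.im (congrFun hv i)
  have hab : a ≠ 0 ∨ b ≠ 0 := by
    by_contra! h
    exact hv0 (funext fun i => Complex.ext (congrFun h.1 i) (congrFun h.2 i))
  have hcomm : b ⬝ᵥ (X *ᵥ a) = a ⬝ᵥ (X *ᵥ b) := by
    rw [dotProduct_mulVec, ← mulVec_transpose, hXs.eq, dotProduct_comm]
  have nonnegX : ∀ x : Fin n → ℝ, 0 ≤ x ⬝ᵥ (X *ᵥ x) := fun x => by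
    simpa using hX.posSemidef.dotProduct_mulVec_nonneg x
  have nonpos : ∀ x : Fin n → ℝ, x ⬝ᵥ ((F * X + X * Fᵀ) *ᵥ x) ≤ 0 := fun x => by
    rcases eq_or_ne x 0 with rfl | hx
    · simp
    · exact (hFX x hx).le
  have hsum : a ⬝ᵥ ((F * X + X * Fᵀ) *ᵥ a) + b ⬝ᵥ ((F * X + X * Fᵀ) *ᵥ b) < 0 := by
    rcases hab with h | h
    · exact add_neg_of_neg_of_nonpos (hFX _ h) (nonpos _)
    · exact add_neg_of_nonpos_of_neg (nonpos _) (hFX _ h)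
  rw [dotProduct_lyapunov_mulVec F hXs, dotProduct_lyapunov_mulVec F hXs, ha, hb] at hsum
  simp only [sub_dotProduct, add_dotProduct, smul_dotProduct, smul_eq_mul, hcomm] at hsum
  by_contra! hre
  nlinarith [mul_nonneg hre (nonnegX a), mul_nonneg hre (nonnegX b)]

/-- Sufficiency of the H₂ LMIs: feasibility yields a gain `K = W X⁻¹` that stabilizes
the closed loop and achieves a squared H₂ norm (Gramian trace) below `γ²`. -/
theorem h2_lmi_sufficiency {n m q p : ℕ}
    (A : Matrix (Fin n) (Fin n) ℝ) (Bu : Matrix (Fin n) (Fin m) ℝ)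
    (Bw : Matrix (Fin n) (Fin q) ℝ) (Cz : Matrix (Fin p) (Fin n) ℝ)
    (Du : Matrix (Fin p) (Fin m) ℝ) (γ : ℝ) (hγ : 0 < γ)
    (X : Matrix (Fin n) (Fin n) ℝ) (W : Matrix (Fin m) (Fin n) ℝ)
    (Z : Matrix (Fin p) (Fin p) ℝ)
    (hX : X.PosDef) (hZ : Z.IsSymm)
    (h1 : (A * X + Bu * W + (A * X + Bu * W)ᵀ + Bw * Bwᵀ).NegDef)
    (h2 : (Matrix.fromBlocks (-Z) (Cz * X + Du * W) (Cz * X + Du * W)ᵀ (-X)).NegDef)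
    (h3 : Z.trace < γ ^ 2) :
    IsHurwitz (A + Bu * (W * X⁻¹)) ∧
    (∃! P : Matrix (Fin n) (Fin n) ℝ,
      (A + Bu * (W * X⁻¹)) * P + P * (A + Bu * (W * X⁻¹))ᵀ + Bw * Bwᵀ = 0) ∧
    (∀ P : Matrix (Fin n) (Fin n) ℝ,
      (A + Bu * (W * X⁻¹)) * P + P * (A + Bu * (W * X⁻¹))ᵀ + Bw * Bwᵀ = 0 →
      ((Cz + Du * (W * X⁻¹)) * P * (Cz + Du * (W * X⁻¹))ᵀ).trace < γ ^ 2) := by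
  have hXs : X.IsSymm := hX.isHermitian
  have hdet : IsUnit X.det := (Matrix.isUnit_iff_isUnit_det X).mp hX.isUnit
  have hWX : W * X⁻¹ * X = W := Matrix.nonsing_inv_mul_cancel_right X W hdet
  have hF : (A + Bu * (W * X⁻¹)) * X = A * X + Bu * W := by
    rw [Matrix.add_mul, Matrix.mul_assoc Bu, hWX]
  have hC : (Cz + Du * (W * X⁻¹)) * X = Cz * X + Du * W := by
    rw [Matrix.add_mul, Matrix.mul_assoc Du, hWX]
  rw [← hF] at h1
  rw [← hC] at h2
  generalize A + Bu * (W * X⁻¹) = F at *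
  generalize Cz + Du * (W * X⁻¹) = C at *
  rw [transpose_mul, hXs.eq] at h1
  have hFX : ∀ x : Fin n → ℝ, x ≠ 0 → x ⬝ᵥ ((F * X + X * Fᵀ) *ᵥ x) < 0 := by
    intro x hx
    have hneg := h1.2 x hx
    have hB := (posSemidef_self_mul_conjTranspose Bw).dotProduct_mulVec_nonneg x
    rw [conjTranspose_eq_transpose_of_trivial, star_trivial] at hB
    rw [add_mulVec, dotProduct_add] at hneg
    linarith
  have hex := existsUnique_lyapunov hX hFX (Bw * Bwᵀ)
  refine ⟨isHurwitz_of_lyapunov hX hFX, hex, fun P hP => ?_⟩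
  have hPs : P.IsSymm := by
    refine hex.unique ?_ hP
    simpa [add_comm (P * Fᵀ)ᵀ, add_comm (F * Pᵀ)] using congrArg transpose hP
  have hXP : (X - P).PosSemidef := by
    refine posSemidef_of_lyapunov hX hFX (hXs.sub hPs) fun x => ?_
    have heq : F * (X - P) + (X - P) * Fᵀ = F * X + X * Fᵀ + Bw * Bwᵀ := by
      rw [← sub_zero (F * X + X * Fᵀ + Bw * Bwᵀ), ← hP]
      noncomm_ring
    rw [heq]
    rcases eq_or_ne x 0 with rfl | hx
    · simp
    · exact (h1.2 x hx).le
  have htr := (hXP.mul_mul_conjTranspose_same C).trace_nonneg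
  rw [conjTranspose_eq_transpose_of_trivial, Matrix.mul_sub, Matrix.sub_mul, trace_sub,
    sub_nonneg] at htr
  exact (htr.trans (trace_le_of_fromBlocks_negDef hXs h2)).trans_lt h3
end

section
/- Let A be an n×n real matrix, B_u an n×m real matrix, B_w an n×q real matrix, C_z a p×n real matrix, D_u a p×m real matrix, γ > 0, and K an m×n real matrix such that A + B_u·K is Hurwitz and the unique solution P of (A + B_u·K)·P + P·(A + B_u·K)ᵀ + B_w·B_wᵀ = 0 satisfies trace( (C_z + D_u·K)·P·(C_z + D_u·K)ᵀ ) < γ². Then there exist a symmetric positive definite n×n real matrix X, the matrix W = K·X, and a symmetric p×p real matrix Z such that: (i) A·X + B_u·W + (A·X + B_u·W)ᵀ + B_w·B_wᵀ is negative definite; (ii) the block matrix [[−Z, C_z·X + D_u·W],[(C_z·X + D_u·W)ᵀ, −X]] is negative definite; and (iii) trace(Z) < γ². -/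
open Matrix
open scoped Matrix

open Filter Topology

/-- The powers of an element of spectral radius less than one tend to zero. -/
theorem tendsto_pow_nhds_zero_of_spectralRadius_lt_one {R : Type*} [NormedRing R]
    [NormedAlgebra ℂ R] [CompleteSpace R] {a : R} (ha : spectralRadius ℂ a < 1) :
    Tendsto (fun k : ℕ => a ^ k) atTop (𝓝 0) := by
  obtain ⟨r, har, hr⟩ := exists_between ha
  have hpow : ∀ᶠ k : ℕ in atTop, (‖a ^ k‖₊ : ENNReal) ≤ r ^ k := by
    filter_upwards [(spectrum.pow_nnnorm_pow_one_div_tendsto_nhds_spectralRadius a).eventually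
      (gt_mem_nhds har), eventually_gt_atTop 0] with k hk hk0
    have hk0' : (k : ℝ) ≠ 0 := by positivity
    calc (‖a ^ k‖₊ : ENNReal) = ((‖a ^ k‖₊ : ENNReal) ^ (1 / k : ℝ)) ^ k := by
          rw [← ENNReal.rpow_natCast, ← ENNReal.rpow_mul, one_div_mul_cancel hk0',
            ENNReal.rpow_one]
      _ ≤ r ^ k := by gcongr
  rw [tendsto_iff_edist_tendsto_0]
  refine tendsto_of_tendsto_of_tendsto_of_le_of_le' tendsto_const_nhds
    (ENNReal.tendsto_pow_atTop_nhds_zero_of_lt_one hr) (.of_forall fun _ => zero_le) ?_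
  simpa [edist_zero_right, enorm_eq_nnnorm] using hpow

namespace Matrix

section LinftyOp

attribute [local instance] Matrix.linftyOpNormedRing Matrix.linftyOpNormedAlgebra

/-- The powers of a complex matrix whose eigenvalues lie in the open unit disc tend to zero. -/
theorem tendsto_pow_nhds_zero_of_spectrum {n : Type*} [Fintype n] [DecidableEq n]
    {M : Matrix n n ℂ} (hM : ∀ μ ∈ spectrum ℂ M, ‖μ‖ < 1) :
    Tendsto (fun k : ℕ => M ^ k) atTop (𝓝 0) := by
  have : CompleteSpace (Matrix n n ℂ) := FiniteDimensional.complete ℂ _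
  apply tendsto_pow_nhds_zero_of_spectralRadius_lt_one
  rcases (spectrum ℂ M).eq_empty_or_nonempty with h | h
  · simp [spectralRadius, h]
  · exact_mod_cast spectrum.spectralRadius_lt_of_forall_lt_of_nonempty (r := 1) h
      fun μ hμ => by exact_mod_cast hM μ hμ

end LinftyOp

theorem tendsto_pow_nhds_zero_of_map_ofReal {n : Type*} [Fintype n] [DecidableEq n]
    {M : Matrix n n ℝ}
    (hM : Tendsto (fun k : ℕ => (M.map (Complex.ofReal : ℝ → ℂ)) ^ k) atTop (𝓝 0)) :
    Tendsto (fun k : ℕ => M ^ k) atTop (𝓝 0) := by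
  have hre : Continuous fun N : Matrix n n ℂ => N.map Complex.re :=
    continuous_id.matrix_map Complex.continuous_re
  have h := (hre.tendsto 0).comp hM
  have hpow : ∀ k : ℕ, M.map (Complex.ofReal : ℝ → ℂ) ^ k = (M ^ k).map Complex.ofReal :=
    fun k => (map_pow (Complex.ofRealHom.mapMatrix (m := n)) M k).symm
  simpa [Function.comp_def, hpow, Matrix.map_map, Matrix.map_zero] using h

/-- Spectrum of the Cayley transform `S (1 + F)`, where `S` inverts `1 - F`. -/
theorem norm_lt_one_of_mem_spectrum_cayley {n : Type*} [Fintype n] [DecidableEq n]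
    {F S : Matrix n n ℂ} (hF : ∀ μ ∈ spectrum ℂ F, μ.re < 0) (hS : S * (1 - F) = 1)
    {μ : ℂ} (hμ : μ ∈ spectrum ℂ (S * (1 + F))) : ‖μ‖ < 1 := by
  have hSu : IsUnit S := IsUnit.of_mul_eq_one _ hS
  have hfac : algebraMap ℂ (Matrix n n ℂ) μ - S * (1 + F) =
      S * ((μ - 1) • (1 : Matrix n n ℂ) - (μ + 1) • F) := by
    have h : algebraMap ℂ (Matrix n n ℂ) μ = S * (μ • (1 - F)) := by
      rw [mul_smul_comm, hS, Algebra.algebraMap_eq_smul_one]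
    rw [h, ← mul_sub]
    congr 1
    module
  have hnot : ¬ IsUnit ((μ - 1) • (1 : Matrix n n ℂ) - (μ + 1) • F) := fun h =>
    hμ (by rw [spectrum.mem_resolventSet_iff, hfac]; exact hSu.mul h)
  have hμ1 : μ + 1 ≠ 0 := by
    intro h
    apply hnot
    have h1 : μ - 1 = -2 := by linear_combination h
    rw [h, h1, zero_smul, sub_zero]
    rw [← Algebra.algebraMap_eq_smul_one]
    exact (IsUnit.mk0 (-2 : ℂ) (by norm_num)).map (algebraMap ℂ (Matrix n n ℂ))
  have hmem : (μ - 1) / (μ + 1) ∈ spectrum ℂ F := by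
    intro h
    apply hnot
    have h2 : (μ - 1) • (1 : Matrix n n ℂ) - (μ + 1) • F =
        algebraMap ℂ (Matrix n n ℂ) (μ + 1) *
          (algebraMap ℂ (Matrix n n ℂ) ((μ - 1) / (μ + 1)) - F) := by
      simp only [Algebra.algebraMap_eq_smul_one, smul_mul_assoc, one_mul, smul_sub, smul_smul]
      rw [mul_div_cancel₀ _ hμ1]
    rw [h2]
    exact ((IsUnit.mk0 _ hμ1).map (algebraMap ℂ (Matrix n n ℂ))).mul h
  have hre := hF _ hmem
  have hpos : 0 < Complex.normSq (μ + 1) := Complex.normSq_pos.mpr hμ1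
  rw [Complex.div_re, ← add_div, div_neg_iff] at hre
  have hnum : (μ - 1).re * (μ + 1).re + (μ - 1).im * (μ + 1).im < 0 := by
    rcases hre with h | h
    · exact absurd h.2 hpos.not_gt
    · exact h.1
  have hsq : ‖μ‖ ^ 2 < 1 := by
    rw [Complex.sq_norm, Complex.normSq_apply]
    simp only [Complex.sub_re, Complex.add_re, Complex.one_re, Complex.sub_im, Complex.add_im,
      Complex.one_im] at hnum
    linarith
  exact (sq_lt_one_iff₀ (norm_nonneg _)).mp hsq

/-- A Stein equation with a contractive coefficient has only the trivial homogeneous solution. -/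
theorem eq_zero_of_eq_mul_mul_transpose {n : Type*} [Fintype n] [DecidableEq n]
    {M P : Matrix n n ℝ} (hM : Tendsto (fun k : ℕ => M ^ k) atTop (𝓝 0))
    (hP : P = M * P * Mᵀ) : P = 0 := by
  have hk : ∀ k : ℕ, M ^ k * P * (M ^ k)ᵀ = P := by
    intro k
    induction k with
    | zero => simp
    | succ k ih =>
      calc M ^ (k + 1) * P * (M ^ (k + 1))ᵀ = M ^ k * (M * P * Mᵀ) * (M ^ k)ᵀ := by
            simp only [pow_succ, transpose_mul, Matrix.mul_assoc]
        _ = P := by rw [← hP, ih]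
  have hc : Continuous fun N : Matrix n n ℝ => N * P * Nᵀ := by fun_prop
  have h := (hc.tendsto 0).comp hM
  simp only [Function.comp_def, hk, Matrix.zero_mul] at h
  exact tendsto_nhds_unique tendsto_const_nhds h

theorem dotProduct_mul_mul_transpose_mulVec {m n : Type*} [Fintype m] [Fintype n]
    (N : Matrix m n ℝ) (P : Matrix n n ℝ) (x y : m → ℝ) :
    x ⬝ᵥ ((N * P * Nᵀ) *ᵥ y) = (Nᵀ *ᵥ x) ⬝ᵥ (P *ᵥ (Nᵀ *ᵥ y)) := by
  rw [mulVec_transpose N x, ← dotProduct_mulVec, mulVec_mulVec, mulVec_mulVec, Matrix.mul_assoc]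

/-- A quadratic form that does not increase along a contraction is nonnegative. -/
theorem dotProduct_mulVec_nonneg_of_le {n : Type*} [Fintype n] [DecidableEq n]
    {M P : Matrix n n ℝ} (hM : Tendsto (fun k : ℕ => M ^ k) atTop (𝓝 0))
    (hP : ∀ x : n → ℝ, x ⬝ᵥ ((M * P * Mᵀ) *ᵥ x) ≤ x ⬝ᵥ (P *ᵥ x)) (x : n → ℝ) :
    0 ≤ x ⬝ᵥ (P *ᵥ x) := by
  have hk : ∀ k : ℕ, ∀ x : n → ℝ, x ⬝ᵥ ((M ^ k * P * (M ^ k)ᵀ) *ᵥ x) ≤ x ⬝ᵥ (P *ᵥ x) := by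
    intro k
    induction k with
    | zero => simp
    | succ k ih =>
      intro x
      calc x ⬝ᵥ ((M ^ (k + 1) * P * (M ^ (k + 1))ᵀ) *ᵥ x)
          = x ⬝ᵥ ((M ^ k * (M * P * Mᵀ) * (M ^ k)ᵀ) *ᵥ x) := by
            simp only [pow_succ, transpose_mul, Matrix.mul_assoc]
        _ ≤ x ⬝ᵥ ((M ^ k * P * (M ^ k)ᵀ) *ᵥ x) := by
            rw [dotProduct_mul_mul_transpose_mulVec (M ^ k),
              dotProduct_mul_mul_transpose_mulVec (M ^ k)]
            exact hP _
        _ ≤ x ⬝ᵥ (P *ᵥ x) := ih x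
  have hc : Continuous fun N : Matrix n n ℝ => x ⬝ᵥ ((N * P * Nᵀ) *ᵥ x) := by fun_prop
  have h := (hc.tendsto 0).comp hM
  simp only [Matrix.zero_mul, Matrix.zero_mulVec, dotProduct_zero] at h
  exact le_of_tendsto h (.of_forall fun k => hk k x)

end Matrix

/-- The Cayley transform turns the Lyapunov equation of a Hurwitz matrix into a Stein equation
with a contractive coefficient. -/
theorem IsHurwitz.exists_stein {n : ℕ} {F : Matrix (Fin n) (Fin n) ℝ} (hF : IsHurwitz F) :
    ∃ M S : Matrix (Fin n) (Fin n) ℝ, IsUnit S ∧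
      Tendsto (fun k : ℕ => M ^ k) atTop (𝓝 0) ∧
      ∀ P : Matrix (Fin n) (Fin n) ℝ,
        P - M * P * Mᵀ = -((2 : ℝ) • (S * (F * P + P * Fᵀ) * Sᵀ)) := by
  let φ : Matrix (Fin n) (Fin n) ℝ →+* Matrix (Fin n) (Fin n) ℂ :=
    Complex.ofRealHom.mapMatrix
  have hdet : IsUnit (1 - F) := by
    have hc : IsUnit (φ (1 - F)) := by
      have h : (1 : ℂ) ∉ spectrum ℂ (φ F) := fun h => by
        have := hF 1 h
        norm_num at this
      simpa [spectrum.notMem_iff] using h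
    rw [Matrix.isUnit_iff_isUnit_det] at hc ⊢
    rw [← RingHom.map_det] at hc
    simpa [isUnit_iff_ne_zero] using hc
  obtain ⟨S, hS⟩ := hdet.exists_left_inv
  have hST : (1 - Fᵀ) * Sᵀ = 1 := by
    rw [← Matrix.transpose_one, ← Matrix.transpose_sub, ← Matrix.transpose_mul, hS]
  refine ⟨S * (1 + F), S, IsUnit.of_mul_eq_one _ hS, ?_, fun P => ?_⟩
  · apply Matrix.tendsto_pow_nhds_zero_of_map_ofReal
    apply Matrix.tendsto_pow_nhds_zero_of_spectrum
    intro μ hμ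
    refine Matrix.norm_lt_one_of_mem_spectrum_cayley (F := φ F) (S := φ S) hF ?_ ?_
    · rw [← map_one φ, ← map_sub, ← map_mul, hS]
    · rwa [← map_one φ, ← map_add, ← map_mul]
  · have h1 : P = S * ((1 - F) * P * (1 - Fᵀ)) * Sᵀ := by
      calc P = (S * (1 - F)) * P * ((1 - Fᵀ) * Sᵀ) := by rw [hS, hST, one_mul, mul_one]
        _ = _ := by simp only [Matrix.mul_assoc]
    nth_rewrite 1 [h1]
    rw [Matrix.transpose_mul, Matrix.transpose_add, Matrix.transpose_one]
    rw [two_smul]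
    noncomm_ring

/-- Injectivity of the Lyapunov operator of a Hurwitz matrix. -/
theorem IsHurwitz.eq_zero_of_lyapunov {n : ℕ} {F P : Matrix (Fin n) (Fin n) ℝ}
    (hF : IsHurwitz F) (hP : F * P + P * Fᵀ = 0) : P = 0 := by
  obtain ⟨M, S, -, hM, h⟩ := hF.exists_stein
  refine Matrix.eq_zero_of_eq_mul_mul_transpose hM (sub_eq_zero.mp ?_)
  simp [h, hP]

/-- Solvability of the Lyapunov equation of a Hurwitz matrix. -/
theorem IsHurwitz.exists_lyapunov_s13 {n : ℕ} {F : Matrix (Fin n) (Fin n) ℝ} (hF : IsHurwitz F)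
    (Q : Matrix (Fin n) (Fin n) ℝ) : ∃ P, F * P + P * Fᵀ = Q := by
  let L : Matrix (Fin n) (Fin n) ℝ →ₗ[ℝ] Matrix (Fin n) (Fin n) ℝ :=
    LinearMap.mulLeft ℝ F + LinearMap.mulRight ℝ Fᵀ
  have hL : Function.Injective L :=
    (injective_iff_map_eq_zero L).mpr fun P hP => hF.eq_zero_of_lyapunov hP
  exact LinearMap.injective_iff_surjective.mp hL Q

/-- The solution of a Lyapunov equation with symmetric right-hand side is symmetric. -/
theorem IsHurwitz.isSymm_of_lyapunov {n : ℕ} {F P Q : Matrix (Fin n) (Fin n) ℝ}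
    (hF : IsHurwitz F) (hQ : Q.IsSymm) (hP : F * P + P * Fᵀ + Q = 0) : P.IsSymm := by
  refine sub_eq_zero.mp (hF.eq_zero_of_lyapunov ?_)
  have hT := congrArg Matrix.transpose hP
  simp only [Matrix.transpose_add, Matrix.transpose_mul, Matrix.transpose_transpose, hQ.eq,
    Matrix.transpose_zero] at hT
  calc F * (Pᵀ - P) + (Pᵀ - P) * Fᵀ
      = (Pᵀ * Fᵀ + F * Pᵀ + Q) - (F * P + P * Fᵀ + Q) := by noncomm_ring
    _ = 0 := by rw [hT, hP, sub_zero]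

/-- The solution of the Lyapunov equation of a Hurwitz matrix is positive definite if the
inhomogeneity is. -/
theorem IsHurwitz.posDef_of_lyapunov {n : ℕ} {F P Q : Matrix (Fin n) (Fin n) ℝ}
    (hF : IsHurwitz F) (hQ : Q.PosDef) (hP : F * P + P * Fᵀ + Q = 0) : P.PosDef := by
  obtain ⟨M, S, hS, hM, h⟩ := hF.exists_stein
  have hR : (S * Q * Sᵀ).PosDef := by
    simpa using hQ.mul_mul_conjTranspose_same (B := S) (Matrix.vecMul_injective_of_isUnit hS)
  have hform : ∀ x, x ⬝ᵥ (P *ᵥ x) = x ⬝ᵥ ((M * P * Mᵀ) *ᵥ x) + 2 * (x ⬝ᵥ ((S * Q * Sᵀ) *ᵥ x)) := by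
    intro x
    have hPQ : P = M * P * Mᵀ + (2 : ℝ) • (S * Q * Sᵀ) := by
      rw [← sub_eq_iff_eq_add', h, eq_neg_of_add_eq_zero_left hP]
      simp
    conv_lhs => rw [hPQ]
    simp [Matrix.add_mulVec, Matrix.smul_mulVec]
  have hnonneg := Matrix.dotProduct_mulVec_nonneg_of_le hM (P := P) fun x => by
    have := hR.posSemidef.dotProduct_mulVec_nonneg x
    simp only [star_trivial] at this
    linarith [hform x]
  have hsymm : P.IsSymm := hF.isSymm_of_lyapunov (by simpa [Matrix.IsSymm] using hQ.isHermitian.eq) hP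
  refine Matrix.PosDef.of_dotProduct_mulVec_pos (by simpa using hsymm) fun x hx => ?_
  have hpos := hR.dotProduct_mulVec_pos hx
  have hM0 : 0 ≤ x ⬝ᵥ ((M * P * Mᵀ) *ᵥ x) := by
    rw [Matrix.dotProduct_mul_mul_transpose_mulVec]
    exact hnonneg _
  simp only [star_trivial] at hpos ⊢
  linarith [hform x]

/-- Completion of squares: the Schur complement criterion for `[[-Z, C X], [(C X)ᵀ, -X]]` when
`Z = C X Cᵀ + ε`. -/
theorem Matrix.PosDef.negDef_fromBlocks {n p : Type*} [Fintype n] [Fintype p] [DecidableEq p]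
    {X : Matrix n n ℝ} (hX : X.PosDef) (C : Matrix p n ℝ) {ε : ℝ} (hε : 0 < ε) :
    (Matrix.fromBlocks (-(C * X * Cᵀ + ε • (1 : Matrix p p ℝ))) (C * X) (C * X)ᵀ (-X)).NegDef := by
  have hXs : Xᵀ = X := by simpa using hX.isHermitian.eq
  refine ⟨?_, fun x hx => ?_⟩
  · simp [Matrix.IsSymm, Matrix.fromBlocks_transpose, hXs, Matrix.mul_assoc]
  · obtain ⟨u, v, rfl⟩ : ∃ u v, x = Sum.elim u v :=
      ⟨x ∘ Sum.inl, x ∘ Sum.inr, (Sum.elim_comp_inl_inr x).symm⟩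
    have key : Sum.elim u v ⬝ᵥ (Matrix.fromBlocks (-(C * X * Cᵀ + ε • (1 : Matrix p p ℝ)))
        (C * X) (C * X)ᵀ (-X) *ᵥ Sum.elim u v) =
        -(ε * (u ⬝ᵥ u)) - (Cᵀ *ᵥ u - v) ⬝ᵥ (X *ᵥ (Cᵀ *ᵥ u - v)) := by
      have huv : v ⬝ᵥ (X *ᵥ (Cᵀ *ᵥ u)) = u ⬝ᵥ ((C * X) *ᵥ v) := by
        rw [dotProduct_mulVec u, ← mulVec_transpose, transpose_mul, hXs, ← mulVec_mulVec,
          dotProduct_comm]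
      have hvu : (Cᵀ *ᵥ u) ⬝ᵥ (X *ᵥ v) = u ⬝ᵥ ((C * X) *ᵥ v) := by
        rw [mulVec_transpose, ← dotProduct_mulVec, mulVec_mulVec]
      have hXC : (C * X)ᵀ *ᵥ u = X *ᵥ (Cᵀ *ᵥ u) := by
        rw [transpose_mul, hXs, mulVec_mulVec]
      rw [fromBlocks_mulVec, sumElim_dotProduct_sumElim]
      simp only [Sum.elim_comp_inl, Sum.elim_comp_inr, neg_mulVec, add_mulVec, smul_mulVec,
        one_mulVec, dotProduct_add, dotProduct_neg, dotProduct_smul, smul_eq_mul, mulVec_sub,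
        dotProduct_sub, sub_dotProduct, dotProduct_mul_mul_transpose_mulVec, hXC, huv, hvu]
      ring
    rw [key]
    by_cases hu : u = 0
    · subst hu
      have hv : v ≠ 0 := by
        rintro rfl
        exact hx (by ext i; cases i <;> rfl)
      have := hX.dotProduct_mulVec_pos hv
      simpa [Matrix.mulVec_neg] using this
    · have h1 : 0 < u ⬝ᵥ u := by
        simpa using Matrix.dotProduct_star_self_pos_iff.mpr hu
      have h2 := hX.posSemidef.dotProduct_mulVec_nonneg (Cᵀ *ᵥ u - v)
      simp only [star_trivial] at h2
      nlinarith [mul_pos hε h1]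

/-- Necessity of the H₂ LMIs: a stabilizing gain achieving a Gramian trace below `γ²`
yields a feasible point of the H₂ LMIs with `W = K X`. -/
theorem h2_lmi_necessity {n m q p : ℕ}
    (A : Matrix (Fin n) (Fin n) ℝ) (Bu : Matrix (Fin n) (Fin m) ℝ)
    (Bw : Matrix (Fin n) (Fin q) ℝ) (Cz : Matrix (Fin p) (Fin n) ℝ)
    (Du : Matrix (Fin p) (Fin m) ℝ) (γ : ℝ) (hγ : 0 < γ)
    (K : Matrix (Fin m) (Fin n) ℝ)
    (hK : IsHurwitz (A + Bu * K))
    (P : Matrix (Fin n) (Fin n) ℝ)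
    (hP : (A + Bu * K) * P + P * (A + Bu * K)ᵀ + Bw * Bwᵀ = 0)
    (htr : ((Cz + Du * K) * P * (Cz + Du * K)ᵀ).trace < γ ^ 2) :
    ∃ (X : Matrix (Fin n) (Fin n) ℝ) (W : Matrix (Fin m) (Fin n) ℝ)
      (Z : Matrix (Fin p) (Fin p) ℝ),
      X.PosDef ∧ W = K * X ∧ Z.IsSymm ∧
      (A * X + Bu * W + (A * X + Bu * W)ᵀ + Bw * Bwᵀ).NegDef ∧
      (Matrix.fromBlocks (-Z) (Cz * X + Du * W) (Cz * X + Du * W)ᵀ (-X)).NegDef ∧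
      Z.trace < γ ^ 2 := by
  have hQ : (Bw * Bwᵀ).PosSemidef := by
    simpa using Matrix.posSemidef_self_mul_conjTranspose Bw
  set F := A + Bu * K with hFdef
  set C := Cz + Du * K with hCdef
  obtain ⟨X₀, hX₀⟩ := hK.exists_lyapunov_s13 (-1)
  obtain ⟨ε, hε, hεtr⟩ : ∃ ε : ℝ, 0 < ε ∧
      (C * P * Cᵀ).trace + ε * ((C * X₀ * Cᵀ).trace + p) < γ ^ 2 := by
    have hc : Continuous fun ε : ℝ => (C * P * Cᵀ).trace + ε * ((C * X₀ * Cᵀ).trace + p) := by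
      fun_prop
    have h : ∀ᶠ ε in 𝓝[>] (0 : ℝ),
        (C * P * Cᵀ).trace + ε * ((C * X₀ * Cᵀ).trace + p) < γ ^ 2 :=
      (hc.tendsto 0).mono_left nhdsWithin_le_nhds |>.eventually (gt_mem_nhds (by simpa using htr))
    obtain ⟨ε, h₁, h₂⟩ := (h.and self_mem_nhdsWithin).exists
    exact ⟨ε, h₂, h₁⟩
  set X := P + ε • X₀ with hXdef
  have hlyap : F * X + X * Fᵀ + Bw * Bwᵀ = -(ε • (1 : Matrix (Fin n) (Fin n) ℝ)) := by
    calc F * X + X * Fᵀ + Bw * Bwᵀ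
        = (F * P + P * Fᵀ + Bw * Bwᵀ) + ε • (F * X₀ + X₀ * Fᵀ) := by
          simp only [hXdef, mul_add, add_mul, mul_smul_comm, smul_mul_assoc, smul_add]
          abel
      _ = -(ε • 1) := by rw [hP, hX₀, zero_add, smul_neg]
  have hX : X.PosDef := by
    refine hK.posDef_of_lyapunov (Matrix.PosDef.posSemidef_add hQ (Matrix.PosDef.one.smul hε)) ?_
    rw [← add_assoc, hlyap, neg_add_cancel]
  have hXs : Xᵀ = X := by simpa using hX.isHermitian.eq
  have hFX : A * X + Bu * (K * X) = F * X := by rw [hFdef, add_mul, Matrix.mul_assoc]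
  have hCX : Cz * X + Du * (K * X) = C * X := by rw [hCdef, Matrix.add_mul, Matrix.mul_assoc]
  refine ⟨X, K * X, C * X * Cᵀ + ε • 1, hX, rfl, ?_, ?_, ?_, ?_⟩
  · simp [Matrix.IsSymm, hXs, Matrix.mul_assoc]
  · rw [hFX, Matrix.transpose_mul, hXs, hlyap]
    refine ⟨by simp [Matrix.IsSymm], fun x hx => ?_⟩
    have hxx : 0 < x ⬝ᵥ x := by simpa using Matrix.dotProduct_star_self_pos_iff.mpr hx
    simpa [Matrix.neg_mulVec, Matrix.smul_mulVec] using mul_pos hε hxx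
  · rw [hCX]
    exact hX.negDef_fromBlocks C hε
  · convert hεtr using 1
    simp [hXdef, Matrix.mul_add, Matrix.add_mul]
    ring
end
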